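/- arXiv:1707.06504 — 2 statements merged into one kernel-verified Lean document; each statement's English description precedes it below -/
import Mathlib

section
/- Compact support of minimizers: let K ∈ L¹(ℝ^N), K ≥ 0, K(x) = K(−x) a.e., K ≢ 0, and m > 0. Then every minimizer f ∈ A_m of P_K over A_m has compact support, i.e. there exists R > 0 such that f = 0 a.e. outside the ball B(0,R). -/
open MeasureTheory Filter Metric
open scoped ENNReal Topology

/-- The admissible class `A_m`: densities `f ∈ L¹(ℝ^N; [0,1])` with `∫ f = m`. -/
def memA {N : ℕ} (m : ℝ) (f : EuclideanSpace ℝ (Fin N) → ℝ) : Prop :=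
  Integrable f volume ∧
    (∀ᵐ x ∂(volume : Measure (EuclideanSpace ℝ (Fin N))), 0 ≤ f x ∧ f x ≤ 1) ∧
    ∫ x, f x = m

/-- The relaxed nonlocal perimeter `P_K(f) = ∬ f(x)(1 - f(y)) K(x-y) dx dy`, in `[0,∞]`. -/
noncomputable def PK {N : ℕ} (K f : EuclideanSpace ℝ (Fin N) → ℝ) : ℝ≥0∞ :=
  ∫⁻ x, ∫⁻ y, ENNReal.ofReal (f x) * ENNReal.ofReal (1 - f y) * ENNReal.ofReal (K (x - y))

/-- The potential `x ↦ ∫ f(y) K(x - y) dy` generated by the density `f`. -/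
noncomputable def potential {N : ℕ} (K f : EuclideanSpace ℝ (Fin N) → ℝ)
    (x : EuclideanSpace ℝ (Fin N)) : ℝ :=
  ∫ y, f y * K (x - y)

section Helpers

variable {N : ℕ} {K f u v : EuclideanSpace ℝ (Fin N) → ℝ}

lemma potential_eq_integral_sub (x : EuclideanSpace ℝ (Fin N)) :
    potential K f x = ∫ t, f (x - t) * K t := by
  rw [potential, ← integral_sub_left_eq_self _ volume x]
  simp

lemma integrable_snd_mul_kernel (hu : Integrable u) (hK : Integrable K) :
    Integrable (fun p : EuclideanSpace ℝ (Fin N) × EuclideanSpace ℝ (Fin N) =>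
      u p.2 * K (p.1 - p.2)) (volume.prod volume) :=
  hu.convolution_integrand (ContinuousLinearMap.mul ℝ ℝ) hK

lemma integrable_fst_mul_kernel (hu : Integrable u) (hK : Integrable K) :
    Integrable (fun p : EuclideanSpace ℝ (Fin N) × EuclideanSpace ℝ (Fin N) =>
      u p.1 * K (p.1 - p.2)) (volume.prod volume) := by
  simpa [Function.comp_def] using (integrable_snd_mul_kernel hu hK.comp_neg).swap

lemma integrable_mul_mul_kernel (hu : Integrable u) (hK : Integrable K) (hv : Measurable v)
    {c : ℝ} (hvc : ∀ x, |v x| ≤ c) :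
    Integrable (fun p : EuclideanSpace ℝ (Fin N) × EuclideanSpace ℝ (Fin N) =>
      u p.1 * v p.2 * K (p.1 - p.2)) (volume.prod volume) := by
  refine ((integrable_fst_mul_kernel hu hK).mul_bdd (c := c)
    (hv.comp measurable_snd).aestronglyMeasurable
    (Eventually.of_forall fun p => hvc p.2)).congr (Eventually.of_forall fun p => ?_)
  simp only [Function.comp]
  ring

lemma integrable_potential (hf : Integrable f) (hK : Integrable K) :
    Integrable (potential K f) :=
  (integrable_snd_mul_kernel hf hK).integral_prod_left

lemma integral_potential (hf : Integrable f) (hK : Integrable K) :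
    ∫ x, potential K f x = (∫ x, f x) * ∫ x, K x :=
  integral_convolution (ContinuousLinearMap.mul ℝ ℝ) hf hK

lemma measurable_potential (hf : Measurable f) (hK : Measurable K) :
    Measurable (potential K f) := by
  refine (StronglyMeasurable.integral_prod_right (f := fun x y => f y * K (x - y))
    (Measurable.stronglyMeasurable ?_)).measurable
  simp only [Function.uncurry_def]
  fun_prop

lemma potential_nonneg (hf : ∀ x, 0 ≤ f x) (hK : ∀ x, 0 ≤ K x) (x : EuclideanSpace ℝ (Fin N)) :
    0 ≤ potential K f x :=
  integral_nonneg fun y => mul_nonneg (hf y) (hK _)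

/-- For an even kernel the potential may be computed with the reflected kernel. -/
lemma integral_mul_kernel_eq_potential
    (hKsymm : ∀ᵐ x ∂(volume : Measure (EuclideanSpace ℝ (Fin N))), K (-x) = K x)
    (y : EuclideanSpace ℝ (Fin N)) : ∫ x, f x * K (x - y) = potential K f y := by
  refine integral_congr_ae ?_
  filter_upwards [(quasiMeasurePreserving_sub_left volume y).ae hKsymm] with x hx
  rw [← hx, neg_sub]

/-- The potential of an integrable density with values in `[0, 1]` vanishes at infinity. -/
lemma exists_potential_lt (hfm : Measurable f) (hf : Integrable f) (hf0 : ∀ x, 0 ≤ f x)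
    (hf1 : ∀ x, f x ≤ 1) (hK : Integrable K) {ε : ℝ} (hε : 0 < ε) :
    ∃ R : ℝ, 0 < R ∧ ∀ x, R ≤ ‖x‖ → potential K f x < ε := by
  obtain ⟨k, hkc, hkε, hkcont, hki⟩ :=
    hK.exists_hasCompactSupport_integral_sub_le (show 0 < ε / 3 by positivity)
  obtain ⟨C, hC⟩ := hkc.exists_bound_of_continuous hkcont
  have hC0 : 0 ≤ C := (norm_nonneg _).trans (hC 0)
  obtain ⟨h, hhc, hhε, hhcont, hhi⟩ :=
    hf.exists_hasCompactSupport_integral_sub_le (show 0 < ε / (3 * (C + 1)) by positivity)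
  obtain ⟨r, hr⟩ := hkc.isCompact.isBounded.subset_closedBall 0
  obtain ⟨s, hs⟩ := hhc.isCompact.isBounded.subset_closedBall 0
  refine ⟨|r| + |s| + 1, by positivity, fun x hx => ?_⟩
  have hzero : ∀ y, h y * k (x - y) = 0 := by
    intro y
    by_contra hne
    have hy := hs (subset_tsupport _ (Function.mem_support.2 (left_ne_zero_of_mul hne)))
    have hxy := hr (subset_tsupport _ (Function.mem_support.2 (right_ne_zero_of_mul hne)))
    rw [mem_closedBall_zero_iff] at hy hxy
    have := norm_add_le y (x - y)
    rw [add_sub_cancel] at this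
    linarith [le_abs_self r, le_abs_self s]
  have hi1 : Integrable fun y => ‖K (x - y) - k (x - y)‖ := ((hK.sub hki).comp_sub_left x).norm
  have hi2 : Integrable fun y => C * ‖f y - h y‖ := ((hf.sub hhi).norm).const_mul C
  have hle : potential K f x ≤ ∫ y, (‖K (x - y) - k (x - y)‖ + C * ‖f y - h y‖) := by
    refine integral_mono ?_ (hi1.add hi2) fun y => ?_
    · exact (hK.comp_sub_left x).bdd_mul (c := 1) hfm.aestronglyMeasurable
        (Eventually.of_forall fun y => by
          rw [Real.norm_eq_abs, abs_of_nonneg (hf0 y)]; exact hf1 y)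
    · have e : f y * K (x - y)
          = f y * (K (x - y) - k (x - y)) + (f y - h y) * k (x - y) := by
        linear_combination hzero y
      have h1 : f y * (K (x - y) - k (x - y)) ≤ ‖K (x - y) - k (x - y)‖ := by
        refine (mul_le_mul_of_nonneg_left (le_abs_self _) (hf0 y)).trans ?_
        exact mul_le_of_le_one_left (abs_nonneg _) (hf1 y)
      have h2 : (f y - h y) * k (x - y) ≤ C * ‖f y - h y‖ := by
        refine (le_abs_self _).trans ?_
        rw [abs_mul, mul_comm]
        exact mul_le_mul_of_nonneg_right (hC _) (abs_nonneg _)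
      simp only [e]
      exact add_le_add h1 h2
  rw [integral_add hi1 hi2, integral_const_mul,
    integral_sub_left_eq_self (fun z => ‖K z - k z‖) volume x] at hle
  have h3 : C * ∫ y, ‖f y - h y‖ ≤ C * (ε / (3 * (C + 1))) := mul_le_mul_of_nonneg_left hhε hC0
  have h4 : C * (ε / (3 * (C + 1))) ≤ ε / 3 := by
    rw [mul_div_assoc', div_le_div_iff₀ (by positivity) (by positivity)]
    nlinarith
  linarith

lemma PK_congr_ae {g : EuclideanSpace ℝ (Fin N) → ℝ} (h : f =ᵐ[volume] g) :
    PK K f = PK K g := by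
  unfold PK
  refine lintegral_congr_ae ?_
  filter_upwards [h] with x hx
  refine lintegral_congr_ae ?_
  filter_upwards [h] with y hy
  rw [hx, hy]

lemma PK_eq_ofReal (hKm : Measurable K) (hK0 : ∀ x, 0 ≤ K x) (hK : Integrable K)
    (hfm : Measurable f) (hf : Integrable f) (hf0 : ∀ x, 0 ≤ f x) (hf1 : ∀ x, f x ≤ 1) :
    PK K f = ENNReal.ofReal
      (∫ p, f p.1 * (1 - f p.2) * K (p.1 - p.2) ∂(volume.prod volume)) := by
  have hi : Integrable (fun p : EuclideanSpace ℝ (Fin N) × EuclideanSpace ℝ (Fin N) =>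
      f p.1 * (1 - f p.2) * K (p.1 - p.2)) (volume.prod volume) :=
    integrable_mul_mul_kernel (v := fun y => 1 - f y) (c := 1) hf hK (by fun_prop) fun x => by
      rw [abs_le]; constructor <;> linarith [hf0 x, hf1 x]
  have h0 : ∀ p : EuclideanSpace ℝ (Fin N) × EuclideanSpace ℝ (Fin N),
      0 ≤ f p.1 * (1 - f p.2) * K (p.1 - p.2) := fun p =>
    mul_nonneg (mul_nonneg (hf0 _) (sub_nonneg.2 (hf1 _))) (hK0 _)
  rw [ofReal_integral_eq_lintegral_ofReal hi (Eventually.of_forall h0),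
    lintegral_prod _ (Measurable.aemeasurable (by fun_prop))]
  unfold PK
  refine lintegral_congr fun x => lintegral_congr fun y => ?_
  rw [ENNReal.ofReal_mul (mul_nonneg (hf0 _) (sub_nonneg.2 (hf1 _))), ENNReal.ofReal_mul (hf0 _)]

/-- First variation inequality: a zero-mean perturbation that is admissible for small times cannot
increase the interaction with the potential of a minimizer. -/
lemma integral_mul_potential_nonpos {m : ℝ} (hKm : Measurable K) (hK0 : ∀ x, 0 ≤ K x)
    (hKsymm : ∀ᵐ x ∂(volume : Measure (EuclideanSpace ℝ (Fin N))), K (-x) = K x)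
    (hK : Integrable K) (hfm : Measurable f) (hfA : memA m f)
    (hf0 : ∀ x, 0 ≤ f x) (hf1 : ∀ x, f x ≤ 1)
    (hmin : ∀ g : EuclideanSpace ℝ (Fin N) → ℝ, memA m g → PK K f ≤ PK K g)
    (hum : Measurable u) (hu : Integrable u) {c : ℝ} (huc : ∀ x, |u x| ≤ c)
    (hu0 : ∫ x, u x = 0) {t₀ : ℝ} (ht₀ : 0 < t₀)
    (hadm : ∀ t, 0 < t → t ≤ t₀ → ∀ x, 0 ≤ f x + t * u x ∧ f x + t * u x ≤ 1) :
    ∫ x, u x * potential K f x ≤ 0 := by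
  have hf := hfA.1
  have hfb : ∀ x, |f x| ≤ 1 := fun x => abs_le.2 ⟨by linarith [hf0 x], hf1 x⟩
  have h1fb : ∀ x, |1 - f x| ≤ 1 := fun x =>
    abs_le.2 ⟨by linarith [hf1 x], by linarith [hf0 x]⟩
  have i₁ := integrable_mul_mul_kernel (v := fun y => 1 - f y) hf hK (by fun_prop) h1fb
  have i₂ := integrable_mul_mul_kernel (v := fun _ => 1) (c := 1) hu hK measurable_const (by simp)
  have i₃ := integrable_mul_mul_kernel hu hK hfm hfb
  have i₄ := integrable_mul_mul_kernel hf hK hum huc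
  have i₅ := integrable_mul_mul_kernel hu hK hum huc
  have e₂ : ∫ p, u p.1 * 1 * K (p.1 - p.2) ∂(volume.prod volume) = 0 := by
    rw [integral_prod _ i₂]
    simp only [mul_one, integral_const_mul, integral_sub_left_eq_self, integral_mul_const, hu0,
      zero_mul]
  have e₃ : ∫ p, u p.1 * f p.2 * K (p.1 - p.2) ∂(volume.prod volume)
      = ∫ x, u x * potential K f x := by
    rw [integral_prod _ i₃]
    simp only [mul_assoc, integral_const_mul, potential]
  have e₄ : ∫ p, f p.1 * u p.2 * K (p.1 - p.2) ∂(volume.prod volume)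
      = ∫ x, u x * potential K f x := by
    rw [integral_prod_symm _ i₄]
    refine integral_congr_ae (Eventually.of_forall fun y => ?_)
    simp only [mul_comm (f _) (u _), mul_assoc, integral_const_mul,
      integral_mul_kernel_eq_potential hKsymm]
  set I := ∫ x, u x * potential K f x with hI
  set D := ∫ p, u p.1 * u p.2 * K (p.1 - p.2) ∂(volume.prod volume) with hD
  have key : ∀ t, 0 < t → t ≤ t₀ → 2 * I + t * D ≤ 0 := by
    intro t ht htt
    have hg0 := fun x => (hadm t ht htt x).1
    have hg1 := fun x => (hadm t ht htt x).2
    have hgi : Integrable fun x => f x + t * u x := hf.add (hu.const_mul t)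
    have hgA : memA m fun x => f x + t * u x := by
      refine ⟨hgi, Eventually.of_forall fun x => hadm t ht htt x, ?_⟩
      rw [integral_add hf (hu.const_mul t), integral_const_mul, hu0, hfA.2.2]
      simp
    have hle := hmin _ hgA
    rw [PK_eq_ofReal hKm hK0 hK hfm hf hf0 hf1,
      PK_eq_ofReal hKm hK0 hK (by fun_prop) hgi hg0 hg1, ENNReal.ofReal_le_ofReal_iff
        (integral_nonneg fun p => mul_nonneg (mul_nonneg (hg0 _) (sub_nonneg.2 (hg1 _)))
          (hK0 _))] at hle
    have hexp : ∫ p : EuclideanSpace ℝ (Fin N) × EuclideanSpace ℝ (Fin N),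
        (f p.1 + t * u p.1) * (1 - (f p.2 + t * u p.2)) * K (p.1 - p.2) ∂(volume.prod volume)
        = ∫ p : EuclideanSpace ℝ (Fin N) × EuclideanSpace ℝ (Fin N),
          ((((f p.1 * (1 - f p.2) * K (p.1 - p.2)) + t * (u p.1 * 1 * K (p.1 - p.2)))
          - t * (u p.1 * f p.2 * K (p.1 - p.2))) - t * (f p.1 * u p.2 * K (p.1 - p.2)))
          - t ^ 2 * (u p.1 * u p.2 * K (p.1 - p.2)) ∂(volume.prod volume) := by
      congr 1
      funext p
      ring
    have j₁ := i₁.add (i₂.const_mul t)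
    have j₂ := j₁.sub (i₃.const_mul t)
    have j₃ := j₂.sub (i₄.const_mul t)
    simp only [Pi.add_def, Pi.sub_def] at j₁ j₂ j₃
    rw [hexp, integral_sub j₃ (i₅.const_mul _), integral_sub j₂ (i₄.const_mul _),
      integral_sub j₁ (i₃.const_mul _), integral_add i₁ (i₂.const_mul _)] at hle
    simp only [integral_const_mul] at hle
    rw [e₂, e₃, e₄, ← hD] at hle
    have : t * (2 * I + t * D) ≤ 0 := by nlinarith
    exact nonpos_of_mul_nonpos_right this ht
  by_contra! hpos
  have hden : 0 < |D| + 1 := by positivity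
  have hq : 0 < I / (|D| + 1) := by positivity
  have h := key (min t₀ (I / (|D| + 1))) (lt_min ht₀ hq) (min_le_left _ _)
  set t := min t₀ (I / (|D| + 1)) with ht
  have ht0 : 0 < t := lt_min ht₀ hq
  have h1 : t * (|D| + 1) ≤ I := (le_div_iff₀ hden).1 (min_le_right _ _)
  have h2 : -(t * |D|) ≤ t * D := by nlinarith [neg_abs_le D]
  nlinarith

/-- The complement of a nonzero integrable density interacts nontrivially with it. -/
lemma not_ae_one_sub_mul_potential_eq_zero [NeZero N] {m : ℝ} (hm : 0 < m) (hKm : Measurable K)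
    (hK0 : ∀ x, 0 ≤ K x) (hK : Integrable K)
    (hKne : ¬ (∀ᵐ x ∂(volume : Measure (EuclideanSpace ℝ (Fin N))), K x = 0))
    (hfm : Measurable f) (hfA : memA m f) (hf0 : ∀ x, 0 ≤ f x) (hf1 : ∀ x, f x ≤ 1) :
    ¬ ∀ᵐ x ∂(volume : Measure (EuclideanSpace ℝ (Fin N))),
      (1 - f x) * potential K f x = 0 := by
  intro hzero
  have hint : ∀ x, Integrable fun t => f (x - t) * K t := fun x =>
    hK.bdd_mul (c := 1) (hfm.comp (measurable_const.sub measurable_id)).aestronglyMeasurable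
      (Eventually.of_forall fun y => by
      rw [Real.norm_eq_abs, abs_of_nonneg (hf0 _)]; exact hf1 _)
  have h1 : ∀ᵐ x ∂(volume : Measure (EuclideanSpace ℝ (Fin N))),
      ∀ᵐ z ∂(volume : Measure (EuclideanSpace ℝ (Fin N))),
        (1 - f x) * (f (x - z) * K z) = 0 := by
    filter_upwards [hzero] with x hx
    rw [potential_eq_integral_sub, ← integral_const_mul] at hx
    exact (integral_eq_zero_iff_of_nonneg (fun z => mul_nonneg (sub_nonneg.2 (hf1 _))
      (mul_nonneg (hf0 _) (hK0 _))) ((hint x).const_mul _)).1 hx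
  have hmeas : MeasurableSet {p : EuclideanSpace ℝ (Fin N) × EuclideanSpace ℝ (Fin N) |
      (1 - f p.1) * (f (p.1 - p.2) * K p.2) = 0} :=
    measurableSet_eq_fun (by fun_prop) (by fun_prop)
  rw [Measure.ae_ae_comm (p := fun x z => (1 - f x) * (f (x - z) * K z) = 0) hmeas] at h1
  obtain ⟨z, hKz, hz0, hz⟩ : ∃ z, K z ≠ 0 ∧ z ≠ 0 ∧
      ∀ᵐ x ∂(volume : Measure (EuclideanSpace ℝ (Fin N))),
        (1 - f x) * (f (x - z) * K z) = 0 := by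
    by_contra hcon
    apply hKne
    filter_upwards [h1, Measure.ae_ne volume (0 : EuclideanSpace ℝ (Fin N))] with z hz hz0
    by_contra hKz
    exact hcon ⟨z, hKz, hz0, hz⟩
  have hle : ∀ᵐ x ∂(volume : Measure (EuclideanSpace ℝ (Fin N))), f (x - z) ≤ f x := by
    filter_upwards [hz] with x hx
    rcases mul_eq_zero.1 hx with h | h
    · linarith [hf1 (x - z)]
    · rw [(mul_eq_zero.1 h).resolve_right hKz]
      exact hf0 x
  have hstep : ∀ x, potential K f (x - z) ≤ potential K f x := by
    intro x
    rw [potential_eq_integral_sub, potential_eq_integral_sub]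
    refine integral_mono_ae (hint _) (hint _) ?_
    filter_upwards [(quasiMeasurePreserving_sub_left volume x).ae hle] with t ht
    refine mul_le_mul_of_nonneg_right ?_ (hK0 t)
    rwa [sub_right_comm]
  have hiter : ∀ (n : ℕ) x, potential K f x ≤ potential K f (x + n • z) := by
    intro n x
    induction n with
    | zero => simp
    | succ n ih =>
      refine ih.trans ?_
      have := hstep (x + (n + 1) • z)
      rwa [succ_nsmul, ← add_assoc, add_sub_cancel_right, add_assoc, ← succ_nsmul] at this
  have hV0 : ∀ x, potential K f x = 0 := by
    intro x
    by_contra hne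
    have hpos : 0 < potential K f x := lt_of_le_of_ne (potential_nonneg hf0 hK0 x) (Ne.symm hne)
    obtain ⟨R, hR, hRV⟩ := exists_potential_lt hfm hfA.1 hf0 hf1 hK hpos
    obtain ⟨n, hn⟩ := exists_nat_ge ((R + ‖x‖) / ‖z‖)
    rw [div_le_iff₀ (norm_pos_iff.2 hz0)] at hn
    refine (hRV (x + n • z) ?_).not_ge (hiter n x)
    have h2 := norm_sub_le (x + n • z) x
    rw [add_sub_cancel_left, ← Nat.cast_smul_eq_nsmul ℝ, norm_smul, Real.norm_natCast] at h2
    rw [← Nat.cast_smul_eq_nsmul ℝ]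
    linarith
  have hI := integral_potential hfA.1 hK
  simp only [hV0, integral_zero, hfA.2.2] at hI
  have hKI : ∫ x, K x = 0 := (mul_eq_zero.1 hI.symm).resolve_left hm.ne'
  exact hKne ((integral_eq_zero_iff_of_nonneg hK0 hK).1 hKI)

/-- Compact support of minimizers for pointwise bounded Borel representatives. -/
lemma exists_ae_eq_zero_of_minimizer [NeZero N] {m : ℝ} (hm : 0 < m) (hKm : Measurable K)
    (hK0 : ∀ x, 0 ≤ K x)
    (hKsymm : ∀ᵐ x ∂(volume : Measure (EuclideanSpace ℝ (Fin N))), K (-x) = K x)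
    (hK : Integrable K)
    (hKne : ¬ (∀ᵐ x ∂(volume : Measure (EuclideanSpace ℝ (Fin N))), K x = 0))
    (hfm : Measurable f) (hfA : memA m f) (hf0 : ∀ x, 0 ≤ f x) (hf1 : ∀ x, f x ≤ 1)
    (hmin : ∀ g : EuclideanSpace ℝ (Fin N) → ℝ, memA m g → PK K f ≤ PK K g) :
    ∃ R : ℝ, 0 < R ∧
      ∀ᵐ x ∂(volume : Measure (EuclideanSpace ℝ (Fin N))),
        x ∉ ball (0 : EuclideanSpace ℝ (Fin N)) R → f x = 0 := by
  have hf := hfA.1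
  have hVm : Measurable (potential K f) := measurable_potential hfm hKm
  have hVi : Integrable (potential K f) := integrable_potential hf hK
  have hV0 := potential_nonneg hf0 hK0
  have hSm : ∀ δ, MeasurableSet {x | δ < potential K f x} := fun δ =>
    measurableSet_lt measurable_const hVm
  have hSi : ∀ δ, 0 < δ → Integrable ({x | δ < potential K f x}.indicator fun x => 1 - f x) := by
    intro δ hδ
    rw [integrable_indicator_iff (hSm δ)]
    exact (integrableOn_const (hVi.measure_gt_lt_top hδ).ne).sub hf.integrableOn
  have hS0 : ∀ δ x, 0 ≤ {x | δ < potential K f x}.indicator (fun x => 1 - f x) x := fun δ x =>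
    Set.indicator_nonneg (fun y _ => sub_nonneg.2 (hf1 y)) x
  obtain ⟨δ, hδ, hb⟩ : ∃ δ : ℝ, 0 < δ ∧
      0 < ∫ x, {x | δ < potential K f x}.indicator (fun x => 1 - f x) x := by
    by_contra! hcon
    apply not_ae_one_sub_mul_potential_eq_zero hm hKm hK0 hK hKne hfm hfA hf0 hf1
    have hall : ∀ᵐ x ∂(volume : Measure (EuclideanSpace ℝ (Fin N))), ∀ n : ℕ,
        {x | 1 / ((n : ℝ) + 1) < potential K f x}.indicator (fun x => 1 - f x) x = 0 := by
      rw [ae_all_iff]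
      intro n
      exact (integral_eq_zero_iff_of_nonneg (hS0 _) (hSi _ (by positivity))).1
        ((hcon _ (by positivity)).antisymm (integral_nonneg (hS0 _)))
    filter_upwards [hall] with x hx
    rcases (hV0 x).eq_or_lt with h | h
    · rw [← h, mul_zero]
    · obtain ⟨n, hn⟩ := exists_nat_one_div_lt h
      have := hx n
      rw [Set.indicator_of_mem (by exact hn)] at this
      rw [this, zero_mul]
  set S := {x | δ < potential K f x} with hS
  set T := {x | potential K f x ≤ δ / 2} with hT
  have hTm : MeasurableSet T := measurableSet_le hVm measurable_const
  have hTi : Integrable (T.indicator f) := hf.indicator hTm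
  have hT0 : ∀ x, 0 ≤ T.indicator f x := fun x => Set.indicator_nonneg (fun y _ => hf0 y) x
  set b := ∫ x, S.indicator (fun x => 1 - f x) x with hbdef
  set a := ∫ x, T.indicator f x with hadef
  have ha0 : 0 ≤ a := integral_nonneg hT0
  have ha : a = 0 := by
    by_contra hne
    have ha : 0 < a := lt_of_le_of_ne ha0 (Ne.symm hne)
    set φ : EuclideanSpace ℝ (Fin N) → ℝ := fun x =>
      a * S.indicator (fun x => 1 - f x) x - b * T.indicator f x with hφ
    have hcases : ∀ x, (x ∈ S ∧ x ∉ T ∧ φ x = a * (1 - f x)) ∨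
        (x ∉ S ∧ x ∈ T ∧ φ x = -(b * f x)) ∨ (x ∉ S ∧ x ∉ T ∧ φ x = 0) := by
      intro x
      by_cases hxS : x ∈ S
      · have hxT : x ∉ T := by
          have hlt : δ < potential K f x := hxS
          exact fun hle : potential K f x ≤ δ / 2 => by linarith
        exact Or.inl ⟨hxS, hxT, by simp [hφ, hxS, hxT]⟩
      · by_cases hxT : x ∈ T
        · exact Or.inr (Or.inl ⟨hxS, hxT, by simp [hφ, hxS, hxT]⟩)
        · exact Or.inr (Or.inr ⟨hxS, hxT, by simp [hφ, hxS, hxT]⟩)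
    have hφm : Measurable φ :=
      (((measurable_const.sub hfm).indicator (hSm δ)).const_mul a).sub
        ((hfm.indicator hTm).const_mul b)
    have hφi : Integrable φ := ((hSi δ hδ).const_mul a).sub (hTi.const_mul b)
    have hφ0 : ∫ x, φ x = 0 := by
      simp only [hφ]
      rw [integral_sub ((hSi δ hδ).const_mul a) (hTi.const_mul b), integral_const_mul,
        integral_const_mul, ← hbdef, ← hadef]
      ring
    have hφb : ∀ x, |φ x| ≤ a + b := by
      intro x
      rw [abs_le]
      have h0 := hf0 x
      have h1 := hf1 x
      rcases hcases x with ⟨-, -, h⟩ | ⟨-, -, h⟩ | ⟨-, -, h⟩ <;> rw [h] <;>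
        constructor <;> nlinarith
    have hadm : ∀ t, 0 < t → t ≤ 1 / (a + b) → ∀ x, 0 ≤ f x + t * φ x ∧ f x + t * φ x ≤ 1 := by
      intro t ht htt x
      rw [le_div_iff₀ (by positivity)] at htt
      have h0 := hf0 x
      have h1 := hf1 x
      have hta : 0 < t * a := by positivity
      have htb : 0 < t * b := by positivity
      rcases hcases x with ⟨-, -, h⟩ | ⟨-, -, h⟩ | ⟨-, -, h⟩ <;> rw [h] <;>
        constructor <;> nlinarith
    have hfirst := integral_mul_potential_nonpos hKm hK0 hKsymm hK hfm hfA hf0 hf1 hmin hφm hφi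
      hφb hφ0 (by positivity) hadm
    have hφVi : Integrable fun x => φ x * potential K f x :=
      hVi.bdd_mul hφm.aestronglyMeasurable (Eventually.of_forall hφb)
    have hlow : ∫ x, b * (δ / 2) * T.indicator f x ≤
        ∫ x, (φ x * potential K f x - δ * φ x) := by
      refine integral_mono (hTi.const_mul _) (hφVi.sub (hφi.const_mul δ)) fun x => ?_
      have h0 := hf0 x
      have h1 := hf1 x
      rcases hcases x with ⟨hxS, hxT, h⟩ | ⟨hxS, hxT, h⟩ | ⟨hxS, hxT, h⟩
      · simp only [h, Set.indicator_of_notMem hxT]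
        have : 0 ≤ a * (1 - f x) * (potential K f x - δ) :=
          mul_nonneg (mul_nonneg ha0 (sub_nonneg.2 h1)) (sub_nonneg.2 (le_of_lt hxS))
        linarith
      · simp only [h, Set.indicator_of_mem hxT]
        have : 0 ≤ b * f x * (δ / 2 - potential K f x) :=
          mul_nonneg (mul_nonneg hb.le h0) (sub_nonneg.2 hxT)
        linarith
      · simp [h, Set.indicator_of_notMem hxT]
    rw [integral_sub hφVi (hφi.const_mul δ), integral_const_mul, integral_const_mul, hφ0,
      ← hadef] at hlow
    have : 0 < b * (δ / 2) * a := by positivity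
    linarith
  have hfT : ∀ᵐ x ∂(volume : Measure (EuclideanSpace ℝ (Fin N))), T.indicator f x = 0 :=
    (integral_eq_zero_iff_of_nonneg hT0 hTi).1 ha
  obtain ⟨R, hR, hRV⟩ := exists_potential_lt hfm hf hf0 hf1 hK (half_pos hδ)
  refine ⟨R, hR, ?_⟩
  filter_upwards [hfT] with x hx hxR
  rw [mem_ball_zero_iff, not_lt] at hxR
  rwa [Set.indicator_of_mem (show x ∈ T from (hRV x hxR).le)] at hx

end Helpers

/-- Compact support of minimizers: every minimizer `f ∈ A_m` of `P_K` over `A_m`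
has compact support: there is `R > 0` with `f = 0` a.e. outside the ball `B(0,R)`. -/
theorem minimizer_compact_support {N : ℕ} (K : EuclideanSpace ℝ (Fin N) → ℝ)
    (hKmeas : Measurable K) (hKnonneg : ∀ x, 0 ≤ K x)
    (hKsymm : ∀ᵐ x ∂(volume : Measure (EuclideanSpace ℝ (Fin N))), K (-x) = K x)
    (hKL1 : Integrable K volume)
    (hKne : ¬ (∀ᵐ x ∂(volume : Measure (EuclideanSpace ℝ (Fin N))), K x = 0))
    (m : ℝ) (hm : 0 < m) (f : EuclideanSpace ℝ (Fin N) → ℝ) (hf : memA m f)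
    (hmin : ∀ g : EuclideanSpace ℝ (Fin N) → ℝ, memA m g → PK K f ≤ PK K g) :
    ∃ R : ℝ, 0 < R ∧
      ∀ᵐ x ∂(volume : Measure (EuclideanSpace ℝ (Fin N))),
        x ∉ ball (0 : EuclideanSpace ℝ (Fin N)) R → f x = 0 := by
  rcases Nat.eq_zero_or_pos N with rfl | hN
  · refine ⟨1, one_pos, Eventually.of_forall fun x hx => absurd ?_ hx⟩
    simp [Subsingleton.elim x 0]
  have : NeZero N := ⟨hN.ne'⟩
  have hfm := hf.1.aemeasurable
  set g : EuclideanSpace ℝ (Fin N) → ℝ := fun x => max 0 (min 1 (hfm.mk f x)) with hg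
  have hfg : f =ᵐ[volume] g := by
    filter_upwards [hfm.ae_eq_mk, hf.2.1] with x hx hx01
    simp only [hg]
    rw [← hx, min_eq_right hx01.2, max_eq_right hx01.1]
  have hgm : Measurable g := measurable_const.max (measurable_const.min hfm.measurable_mk)
  have hg0 : ∀ x, 0 ≤ g x := fun x => le_max_left _ _
  have hg1 : ∀ x, g x ≤ 1 := fun x => max_le zero_le_one (min_le_left _ _)
  have hgA : memA m g := ⟨hf.1.congr hfg, Eventually.of_forall fun x => ⟨hg0 x, hg1 x⟩,
    (integral_congr_ae hfg).symm.trans hf.2.2⟩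
  obtain ⟨R, hR, hRg⟩ := exists_ae_eq_zero_of_minimizer hm hKmeas hKnonneg hKsymm hKL1 hKne hgm
    hgA hg0 hg1 fun h hh => (PK_congr_ae hfg) ▸ hmin h hh
  refine ⟨R, hR, ?_⟩
  filter_upwards [hRg, hfg] with x hx hxg hxR
  rw [hxg, hx hxR]
end

section
/- Second variation inequality: let K ∈ L¹(ℝ^N), K ≥ 0, K(x) = K(−x) a.e., K ≢ 0, m > 0, and let f ∈ A_m minimize P_K over A_m. Then for every ξ ∈ L¹(ℝ^N; [−1,1]) with ∫_{ℝ^N} ξ(x) dx = 0 and ξ = 0 a.e. on {x : f(x) = 0} ∪ {x : f(x) = 1}, one has ∬_{ℝ^N×ℝ^N} ξ(x) ξ(y) K(x−y) dx dy ≤ 0. -/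
open MeasureTheory Filter Metric
open scoped ENNReal Topology

/-- `u(x) v(y) K(x - y)` is integrable on the product as soon as `u`, `K` are integrable and `v` is
essentially bounded. -/
theorem integrable_mul_mul_sub {N : ℕ} {K u v : EuclideanSpace ℝ (Fin N) → ℝ} {C : ℝ}
    (hK : Integrable K volume) (hu : Integrable u volume) (hv : AEStronglyMeasurable v volume)
    (hvC : ∀ᵐ x ∂(volume : Measure (EuclideanSpace ℝ (Fin N))), |v x| ≤ C) :
    Integrable (fun p : EuclideanSpace ℝ (Fin N) × EuclideanSpace ℝ (Fin N) =>
      u p.1 * v p.2 * K (p.1 - p.2)) (volume.prod volume) := by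
  have h := (hu.convolution_integrand (ContinuousLinearMap.mul ℝ ℝ) hK.comp_neg).swap
  have h2 := h.bdd_mul (c := C) (f := fun p => v p.2) hv.comp_snd
    (Measure.quasiMeasurePreserving_snd.ae hvC)
  refine h2.congr (Eventually.of_forall fun p => ?_)
  simp only [Function.comp_apply, Prod.fst_swap, Prod.snd_swap, ContinuousLinearMap.mul_apply',
    neg_sub]
  ring

/-- On `[0,1]`-valued integrable functions the relaxed perimeter is a convergent integral over the
product space. -/
theorem PK_eq_ofReal_integral {N : ℕ} {K f : EuclideanSpace ℝ (Fin N) → ℝ}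
    (hKnonneg : ∀ x, 0 ≤ K x) (hK : Integrable K volume) {m : ℝ} (hf : memA m f) :
    Integrable (fun p : EuclideanSpace ℝ (Fin N) × EuclideanSpace ℝ (Fin N) =>
      f p.1 * (1 - f p.2) * K (p.1 - p.2)) (volume.prod volume) ∧
    0 ≤ ∫ p : EuclideanSpace ℝ (Fin N) × EuclideanSpace ℝ (Fin N),
      f p.1 * (1 - f p.2) * K (p.1 - p.2) ∂(volume.prod volume) ∧
    PK K f = ENNReal.ofReal (∫ p : EuclideanSpace ℝ (Fin N) × EuclideanSpace ℝ (Fin N),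
      f p.1 * (1 - f p.2) * K (p.1 - p.2) ∂(volume.prod volume)) := by
  obtain ⟨hfi, hf01, -⟩ := hf
  have hint := integrable_mul_mul_sub (v := fun y => 1 - f y) (C := 1) hK hfi
    (aestronglyMeasurable_const.sub hfi.1)
    (hf01.mono fun x hx => abs_le.2 ⟨by linarith [hx.2], by linarith [hx.1]⟩)
  have h1 : ∀ᵐ p : EuclideanSpace ℝ (Fin N) × EuclideanSpace ℝ (Fin N) ∂(volume.prod volume),
      0 ≤ f p.1 ∧ f p.1 ≤ 1 := Measure.quasiMeasurePreserving_fst.ae hf01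
  have h2 : ∀ᵐ p : EuclideanSpace ℝ (Fin N) × EuclideanSpace ℝ (Fin N) ∂(volume.prod volume),
      0 ≤ f p.2 ∧ f p.2 ≤ 1 := Measure.quasiMeasurePreserving_snd.ae hf01
  have hnn : 0 ≤ᵐ[volume.prod volume]
      fun p : EuclideanSpace ℝ (Fin N) × EuclideanSpace ℝ (Fin N) =>
        f p.1 * (1 - f p.2) * K (p.1 - p.2) := by
    filter_upwards [h1, h2] with p hp1 hp2
    exact mul_nonneg (mul_nonneg hp1.1 (sub_nonneg.2 hp2.2)) (hKnonneg _)
  refine ⟨hint, integral_nonneg_of_ae hnn, ?_⟩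
  rw [ofReal_integral_eq_lintegral_ofReal hint hnn,
    lintegral_prod _ hint.1.aemeasurable.ennreal_ofReal, PK]
  refine lintegral_congr_ae ?_
  filter_upwards [hf01] with x hx
  refine lintegral_congr_ae ?_
  filter_upwards [hf01] with y hy
  rw [ENNReal.ofReal_mul (mul_nonneg hx.1 (sub_nonneg.2 hy.2)), ENNReal.ofReal_mul hx.1]

/-- If both `f + η` and `f - η` are competitors of a minimizer `f`, then the quadratic form of `K`
is nonpositive at `η`. -/
theorem quadratic_form_nonpos_of_memA_add_sub {N : ℕ} {K f η : EuclideanSpace ℝ (Fin N) → ℝ}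
    (hKnonneg : ∀ x, 0 ≤ K x) (hK : Integrable K volume) {m : ℝ} (hf : memA m f)
    (hmin : ∀ g : EuclideanSpace ℝ (Fin N) → ℝ, memA m g → PK K f ≤ PK K g)
    (hadd : memA m (fun x => f x + η x)) (hsub : memA m (fun x => f x - η x)) :
    ∫ p : EuclideanSpace ℝ (Fin N) × EuclideanSpace ℝ (Fin N),
      η p.1 * η p.2 * K (p.1 - p.2) ∂(volume.prod volume) ≤ 0 := by
  obtain ⟨i0, -, e0⟩ := PK_eq_ofReal_integral hKnonneg hK hf
  obtain ⟨i1, n1, e1⟩ := PK_eq_ofReal_integral hKnonneg hK hadd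
  obtain ⟨i2, n2, e2⟩ := PK_eq_ofReal_integral hKnonneg hK hsub
  have l1 := hmin _ hadd
  have l2 := hmin _ hsub
  rw [e0, e1, ENNReal.ofReal_le_ofReal_iff n1] at l1
  rw [e0, e2, ENNReal.ofReal_le_ofReal_iff n2] at l2
  have key : ∫ p : EuclideanSpace ℝ (Fin N) × EuclideanSpace ℝ (Fin N),
      2 * (η p.1 * η p.2 * K (p.1 - p.2)) ∂(volume.prod volume) =
      ∫ p : EuclideanSpace ℝ (Fin N) × EuclideanSpace ℝ (Fin N),
      (2 * (f p.1 * (1 - f p.2) * K (p.1 - p.2)) -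
        ((f p.1 + η p.1) * (1 - (f p.2 + η p.2)) * K (p.1 - p.2) +
        (f p.1 - η p.1) * (1 - (f p.2 - η p.2)) * K (p.1 - p.2))) ∂(volume.prod volume) := by
    congr 1
    ext p
    ring
  rw [integral_sub, integral_add i1 i2, integral_const_mul, integral_const_mul] at key
  · linarith
  · exact i0.const_mul 2
  · exact i1.add i2

/-- The quadratic form of `K` at a minimizer `f` is nonpositive at every mean-zero function which is
dominated by a multiple of `f (1 - f)`. -/
theorem quadratic_form_nonpos_of_abs_le {N : ℕ} {K f η : EuclideanSpace ℝ (Fin N) → ℝ}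
    (hKnonneg : ∀ x, 0 ≤ K x) (hK : Integrable K volume) {m : ℝ} (hf : memA m f)
    (hmin : ∀ g : EuclideanSpace ℝ (Fin N) → ℝ, memA m g → PK K f ≤ PK K g)
    (hη : Integrable η volume) (hη0 : ∫ x, η x = 0) {M : ℝ} (hM : 0 < M)
    (hηM : ∀ᵐ x ∂(volume : Measure (EuclideanSpace ℝ (Fin N))), |η x| ≤ M * (f x * (1 - f x))) :
    ∫ p : EuclideanSpace ℝ (Fin N) × EuclideanSpace ℝ (Fin N),
      η p.1 * η p.2 * K (p.1 - p.2) ∂(volume.prod volume) ≤ 0 := by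
  have hi : Integrable (fun x => M⁻¹ * η x) volume := hη.const_mul _
  have hb : ∀ᵐ x ∂(volume : Measure (EuclideanSpace ℝ (Fin N))),
      |M⁻¹ * η x| ≤ f x ∧ |M⁻¹ * η x| ≤ 1 - f x := by
    filter_upwards [hηM, hf.2.1] with x hx h01
    have : |M⁻¹ * η x| ≤ f x * (1 - f x) := by
      rw [abs_mul, abs_of_pos (inv_pos.2 hM), inv_mul_le_iff₀ hM]
      exact hx
    constructor <;> nlinarith [h01.1, h01.2]
  have hz : ∫ x, M⁻¹ * η x = 0 := by rw [integral_const_mul, hη0, mul_zero]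
  have h := quadratic_form_nonpos_of_memA_add_sub (η := fun x => M⁻¹ * η x) hKnonneg hK hf hmin
    ⟨hf.1.add hi, hb.mono fun x hx => by
        constructor <;> linarith [abs_le.1 hx.1, abs_le.1 hx.2],
      by rw [integral_add hf.1 hi, hz, hf.2.2, add_zero]⟩
    ⟨hf.1.sub hi, hb.mono fun x hx => by
        constructor <;> linarith [abs_le.1 hx.1, abs_le.1 hx.2],
      by rw [integral_sub hf.1 hi, hz, hf.2.2, sub_zero]⟩
  have e : ∀ p : EuclideanSpace ℝ (Fin N) × EuclideanSpace ℝ (Fin N),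
      M⁻¹ * η p.1 * (M⁻¹ * η p.2) * K (p.1 - p.2) =
        (M⁻¹ * M⁻¹) * (η p.1 * η p.2 * K (p.1 - p.2)) := fun p => by ring
  simp only [e] at h
  rw [integral_const_mul] at h
  exact nonpos_of_mul_nonpos_right h (by positivity)

/-- Truncation of `a` at height `b ≥ 0`, with its elementary bounds. -/
theorem abs_max_neg_min_le {a b : ℝ} (hb : 0 ≤ b) :
    |max (-b) (min a b)| ≤ b ∧ |max (-b) (min a b)| ≤ |a| := by
  constructor
  · exact abs_le.2 ⟨le_max_left _ _, max_le (by linarith) (min_le_right _ _)⟩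
  · rcases le_total a b with h | h
    · rw [min_eq_left h]
      rcases le_total (-b) a with h' | h'
      · rw [max_eq_right h']
      · rw [max_eq_left h', abs_neg, abs_of_nonneg hb, abs_of_nonpos (by linarith)]
        linarith
    · rw [min_eq_right h, max_eq_right (by linarith), abs_of_nonneg hb, abs_of_nonneg (by linarith)]
      exact h

/-- Truncations at heights `n * w` converge, if `a` vanishes when `w` does. -/
theorem tendsto_max_neg_min_nat_mul {a w : ℝ} (hw : 0 ≤ w) (ha : w = 0 → a = 0) :
    Tendsto (fun n : ℕ => max (-(n * w)) (min a (n * w))) atTop (𝓝 a) := by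
  rcases hw.eq_or_lt with h | h
  · simp [ha h.symm, ← h]
  · have ht : Tendsto (fun n : ℕ => (n : ℝ) * w) atTop atTop :=
      tendsto_natCast_atTop_atTop.atTop_mul_const h
    refine tendsto_const_nhds.congr' ?_
    filter_upwards [ht.eventually_ge_atTop |a|] with n hn
    rw [min_eq_left ((le_abs_self a).trans hn), max_eq_right (by linarith [neg_abs_le a])]

/-- Second variation inequality: let `f ∈ A_m` minimize `P_K` over `A_m`. Then
for every `ξ ∈ L¹(ℝ^N; [-1,1])` with `∫ ξ = 0` and `ξ = 0` a.e. on `{f = 0} ∪ {f = 1}`, one has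
`∬ ξ(x) ξ(y) K(x-y) dx dy ≤ 0`. -/
theorem second_variation {N : ℕ} (K : EuclideanSpace ℝ (Fin N) → ℝ)
    (hKmeas : Measurable K) (hKnonneg : ∀ x, 0 ≤ K x)
    (hKsymm : ∀ᵐ x ∂(volume : Measure (EuclideanSpace ℝ (Fin N))), K (-x) = K x)
    (hKL1 : Integrable K volume)
    (hKne : ¬ (∀ᵐ x ∂(volume : Measure (EuclideanSpace ℝ (Fin N))), K x = 0))
    (m : ℝ) (hm : 0 < m) (f : EuclideanSpace ℝ (Fin N) → ℝ) (hf : memA m f)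
    (hmin : ∀ g : EuclideanSpace ℝ (Fin N) → ℝ, memA m g → PK K f ≤ PK K g)
    (ξ : EuclideanSpace ℝ (Fin N) → ℝ) (hξint : Integrable ξ volume)
    (hξ11 : ∀ᵐ x ∂(volume : Measure (EuclideanSpace ℝ (Fin N))), -1 ≤ ξ x ∧ ξ x ≤ 1)
    (hξ0 : ∫ x, ξ x = 0)
    (hξSN : ∀ᵐ x ∂(volume : Measure (EuclideanSpace ℝ (Fin N))),
      (f x = 0 ∨ f x = 1) → ξ x = 0) :
    ∫ x, ∫ y, ξ x * ξ y * K (x - y) ≤ 0 := by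
  have h01 := hf.2.1
  set w : EuclideanSpace ℝ (Fin N) → ℝ := fun x => f x * (1 - f x) with hw
  have hw0 : ∀ᵐ x ∂(volume : Measure (EuclideanSpace ℝ (Fin N))), 0 ≤ w x ∧ w x ≤ 1 := by
    filter_upwards [h01] with x hx
    constructor <;> simp only [hw] <;> nlinarith [hx.1, hx.2]
  have hwi : Integrable w volume :=
    hf.1.mul_bdd (c := 1) (aestronglyMeasurable_const.sub hf.1.1)
      (h01.mono fun x hx => abs_le.2 ⟨by linarith [hx.2], by linarith [hx.1]⟩)
  have hwξ : ∀ᵐ x ∂(volume : Measure (EuclideanSpace ℝ (Fin N))), w x = 0 → ξ x = 0 := by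
    filter_upwards [hξSN] with x hx h
    exact hx ((mul_eq_zero.1 h).imp id fun h => by linarith)
  have hξabs : ∀ᵐ x ∂(volume : Measure (EuclideanSpace ℝ (Fin N))), |ξ x| ≤ 1 :=
    hξ11.mono fun x hx => abs_le.2 hx
  rw [← integral_prod _ (integrable_mul_mul_sub hKL1 hξint hξint.1 hξabs)]
  set W := ∫ x, w x with hW
  have hWnn : 0 ≤ W := integral_nonneg_of_ae (hw0.mono fun x hx => hx.1)
  rcases hWnn.eq_or_lt with hW0 | hWpos
  · have hwz := (integral_eq_zero_iff_of_nonneg_ae (hw0.mono fun x hx => hx.1) hwi).1 hW0.symm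
    have hξz : ∀ᵐ x ∂(volume : Measure (EuclideanSpace ℝ (Fin N))), ξ x = 0 := by
      filter_upwards [hwz, hwξ] with x h1 h2 using h2 h1
    refine (integral_eq_zero_of_ae ?_).le
    filter_upwards [Measure.quasiMeasurePreserving_fst.ae hξz] with p hp
    simp [hp]
  set t : ℕ → EuclideanSpace ℝ (Fin N) → ℝ := fun n x => max (-(n * w x)) (min (ξ x) (n * w x))
    with ht
  have htb : ∀ n, ∀ᵐ x ∂(volume : Measure (EuclideanSpace ℝ (Fin N))),
      |t n x| ≤ n * w x ∧ |t n x| ≤ |ξ x| := fun n =>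
    hw0.mono fun x hx => abs_max_neg_min_le (mul_nonneg n.cast_nonneg hx.1)
  have htm : ∀ n, AEStronglyMeasurable (t n) volume := fun n =>
    (hwi.const_mul (n : ℝ)).1.neg.sup (hξint.1.inf (hwi.const_mul (n : ℝ)).1)
  have hti : ∀ n, Integrable (t n) volume := fun n =>
    hξint.mono (htm n) ((htb n).mono fun x hx => hx.2)
  have htlim : ∀ᵐ x ∂(volume : Measure (EuclideanSpace ℝ (Fin N))),
      Tendsto (fun n => t n x) atTop (𝓝 (ξ x)) := by
    filter_upwards [hw0, hwξ] with x h1 h2 using tendsto_max_neg_min_nat_mul h1.1 h2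
  set c : ℕ → ℝ := fun n => (∫ x, t n x) / W with hc
  have hclim : Tendsto c atTop (𝓝 0) := by
    have := tendsto_integral_of_dominated_convergence (fun x => |ξ x|) htm hξint.abs
      (fun n => (htb n).mono fun x hx => hx.2) htlim
    rw [hξ0] at this
    simpa using this.div_const W
  obtain ⟨B, hB⟩ : ∃ B, ∀ n, |c n| ≤ B := by
    obtain ⟨B, hB⟩ := hclim.abs.bddAbove_range
    exact ⟨B, fun n => hB ⟨n, rfl⟩⟩
  have hB0 : 0 ≤ B := (abs_nonneg _).trans (hB 0)
  set η : ℕ → EuclideanSpace ℝ (Fin N) → ℝ := fun n x => t n x - c n * w x with hη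
  have hηi : ∀ n, Integrable (η n) volume := fun n => (hti n).sub (hwi.const_mul _)
  have hη0 : ∀ n, ∫ x, η n x = 0 := fun n => by
    simp only [hη]
    rw [integral_sub (hti n) (hwi.const_mul _), integral_const_mul, ← hW, hc]
    field_simp
    ring
  have hcw : ∀ n, ∀ᵐ x ∂(volume : Measure (EuclideanSpace ℝ (Fin N))),
      |η n x| ≤ |t n x| + B * w x := fun n => by
    filter_upwards [hw0] with x hx
    refine (abs_sub _ _).trans (add_le_add le_rfl ?_)
    rw [abs_mul, abs_of_nonneg hx.1]
    exact mul_le_mul_of_nonneg_right (hB n) hx.1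
  have hneg : ∀ n, ∫ p : EuclideanSpace ℝ (Fin N) × EuclideanSpace ℝ (Fin N),
      η n p.1 * η n p.2 * K (p.1 - p.2) ∂(volume.prod volume) ≤ 0 := fun n => by
    refine quadratic_form_nonpos_of_abs_le hKnonneg hKL1 hf hmin (hηi n) (hη0 n)
      (M := n + B + 1) (by positivity) ?_
    filter_upwards [hcw n, htb n, hw0] with x h1 h2 h3
    change |η n x| ≤ (n + B + 1) * w x
    linarith [h2.1, h3.1]
  set g : EuclideanSpace ℝ (Fin N) → ℝ := fun x => |ξ x| + B * w x with hg
  have hgi : Integrable g volume := hξint.abs.add (hwi.const_mul B)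
  have hgb : ∀ᵐ x ∂(volume : Measure (EuclideanSpace ℝ (Fin N))), |g x| ≤ 1 + B := by
    filter_upwards [hξabs, hw0] with x h1 h2
    rw [abs_of_nonneg (add_nonneg (abs_nonneg _) (mul_nonneg hB0 h2.1))]
    exact add_le_add h1 (mul_le_of_le_one_right hB0 h2.2)
  have hηg : ∀ n, ∀ᵐ x ∂(volume : Measure (EuclideanSpace ℝ (Fin N))), |η n x| ≤ g x := fun n => by
    filter_upwards [hcw n, htb n] with x h1 h2
    exact h1.trans (add_le_add h2.2 le_rfl)
  have hηlim : ∀ᵐ x ∂(volume : Measure (EuclideanSpace ℝ (Fin N))),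
      Tendsto (fun n => η n x) atTop (𝓝 (ξ x)) := by
    filter_upwards [htlim] with x hx
    simpa using hx.sub (hclim.mul_const (w x))
  refine le_of_tendsto (tendsto_integral_of_dominated_convergence
    (fun p : EuclideanSpace ℝ (Fin N) × EuclideanSpace ℝ (Fin N) =>
      g p.1 * g p.2 * K (p.1 - p.2)) (fun n => ?_)
    (integrable_mul_mul_sub hKL1 hgi hgi.1 hgb) (fun n => ?_) ?_) (Eventually.of_forall hneg)
  · refine (integrable_mul_mul_sub (C := 1 + B) hKL1 (hηi n) (hηi n).1 ?_).1
    filter_upwards [hηg n, hgb] with x h1 h2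
    exact h1.trans ((le_abs_self _).trans h2)
  · filter_upwards [Measure.quasiMeasurePreserving_fst.ae (hηg n),
      Measure.quasiMeasurePreserving_snd.ae (hηg n)] with p h1 h2
    rw [Real.norm_eq_abs, abs_mul, abs_mul, abs_of_nonneg (hKnonneg _)]
    exact mul_le_mul_of_nonneg_right
      (mul_le_mul h1 h2 (abs_nonneg _) ((abs_nonneg _).trans h1)) (hKnonneg _)
  · filter_upwards [Measure.quasiMeasurePreserving_fst.ae hηlim,
      Measure.quasiMeasurePreserving_snd.ae hηlim] with p h1 h2
    exact (h1.mul h2).mul_const _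
end
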